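/- Let Q be a finite set and let E = Q^n be equipped with the Hamming distance. If a finite nonempty set S ⊆ E is written as a union S = T ∪ T' of two nonempty subsets, then hull(S) = ⋃_{x ∈ hull(T), x' ∈ hull(T')} [x, x']. -/

import Mathlib

variable {Q : Type*} [Fintype Q] [DecidableEq Q] {n : ℕ}

/-- The metric segment `[x,y]` in the Hamming space `Q^n`. -/
def hammingSeg (x y : Fin n → Q) : Set (Fin n → Q) :=
  {z | hammingDist x y = hammingDist x z + hammingDist z y}

/-- A subset `K ⊆ Q^n` is convex (for the Hamming metric) if it contains the segment
between any two of its points. -/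
def HammingConvex (K : Set (Fin n → Q)) : Prop :=
  ∀ x ∈ K, ∀ y ∈ K, hammingSeg x y ⊆ K

/-- The convex hull of `S ⊆ Q^n`: the smallest Hamming-convex set containing `S`. -/
def hammingHull (S : Set (Fin n → Q)) : Set (Fin n → Q) :=
  ⋂₀ {K : Set (Fin n → Q) | HammingConvex K ∧ S ⊆ K}

/-- A point lies on a Hamming segment iff each coordinate agrees with one of the endpoints. -/
theorem mem_hammingSeg_iff {α : Type*} [DecidableEq α]
    {x y z : Fin n → α} :
    z ∈ hammingSeg x y ↔ ∀ i, z i = x i ∨ z i = y i := by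
  have hle : ∀ i ∈ Finset.univ, (if x i ≠ y i then 1 else 0) ≤
      (if x i ≠ z i then 1 else 0) + (if z i ≠ y i then 1 else 0) := by
    intro i _
    grind
  simp only [hammingSeg, Set.mem_ofPred_eq, hammingDist, Finset.card_filter]
  rw [← Finset.sum_add_distrib, Finset.sum_eq_sum_iff_of_le hle]
  refine forall_congr' fun i => ?_
  simp only [Finset.mem_univ, true_imp_iff]
  grind

/-- A nonempty Hamming-convex set contains the product of its coordinate projections. -/
theorem HammingConvex.mem_of_forall_exists {α : Type*} [DecidableEq α]
    {K : Set (Fin n → α)} (hK : HammingConvex K)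
    (hne : K.Nonempty) {z : Fin n → α} (hz : ∀ i, ∃ x ∈ K, x i = z i) : z ∈ K := by
  have key : ∀ s : Finset (Fin n), ∃ w ∈ K, ∀ i ∈ s, w i = z i := by
    intro s
    induction s using Finset.induction_on with
    | empty => exact hne.imp fun w hw => ⟨hw, by simp⟩
    | insert j s _ ih =>
      obtain ⟨w, hw, hws⟩ := ih
      obtain ⟨x, hx, hxj⟩ := hz j
      refine ⟨Function.update w j (z j), hK w hw x hx (mem_hammingSeg_iff.2 fun i => ?_),
        fun i hi => ?_⟩ <;> grind [Function.update_apply]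
  obtain ⟨w, hw, hwz⟩ := key Finset.univ
  rwa [← funext fun i => hwz i (Finset.mem_univ i)]

/-- The Hamming hull of a nonempty set is the product of its coordinate projections. -/
theorem mem_hammingHull_iff {α : Type*} [DecidableEq α]
    {S : Set (Fin n → α)} (hS : S.Nonempty) {z : Fin n → α} :
    z ∈ hammingHull S ↔ ∀ i, ∃ x ∈ S, x i = z i := by
  constructor
  · intro hz
    refine hz {w | ∀ i, ∃ x ∈ S, x i = w i} ⟨?_, fun w hw i => ⟨w, hw, rfl⟩⟩
    intro x hx y hy w hw i
    rcases mem_hammingSeg_iff.1 hw i with h | h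
    · exact h ▸ hx i
    · exact h ▸ hy i
  · rintro hz K ⟨hK, hSK⟩
    exact hK.mem_of_forall_exists (hS.mono hSK) fun i =>
      (hz i).imp fun x hx => ⟨hSK hx.1, hx.2⟩

/-- Some point of the hull of `T` agrees with `z` at every coordinate where a point of `T` does. -/
theorem exists_mem_hammingHull_forall_eq {α : Type*} [DecidableEq α]
    {T : Set (Fin n → α)} (hT : T.Nonempty)
    (z : Fin n → α) :
    ∃ x ∈ hammingHull T, ∀ i, (∃ t ∈ T, t i = z i) → x i = z i := by
  classical
  obtain ⟨t, ht⟩ := hT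
  refine ⟨fun i => if ∃ t ∈ T, t i = z i then z i else t i,
    (mem_hammingHull_iff ⟨t, ht⟩).2 fun i => ?_, fun i hi => if_pos hi⟩
  split_ifs with h
  · exact h
  · exact ⟨t, ht, rfl⟩

/-- If a finite nonempty set `S ⊆ Q^n` is written as a union `S = T ∪ T'` of two
nonempty subsets, then `hull(S) = ⋃_{x ∈ hull(T), x' ∈ hull(T')} [x, x']`. -/
theorem hammingHull_union (S T T' : Set (Fin n → Q)) (hfin : S.Finite)
    (hT : T.Nonempty) (hT' : T'.Nonempty) (hS : S = T ∪ T') :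
    hammingHull S =
      ⋃ x ∈ hammingHull T, ⋃ x' ∈ hammingHull T', hammingSeg x x' := by
  subst hS
  ext z
  simp only [Set.mem_iUnion, exists_prop, mem_hammingHull_iff (hT.mono Set.subset_union_left)]
  constructor
  · intro hz
    obtain ⟨x, hx, hxz⟩ := exists_mem_hammingHull_forall_eq hT z
    obtain ⟨x', hx', hxz'⟩ := exists_mem_hammingHull_forall_eq hT' z
    refine ⟨x, hx, x', hx', mem_hammingSeg_iff.2 fun i => ?_⟩
    obtain ⟨t, ht | ht, hti⟩ := hz i
    · exact Or.inl (hxz i ⟨t, ht, hti⟩).symm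
    · exact Or.inr (hxz' i ⟨t, ht, hti⟩).symm
  · rintro ⟨x, hx, x', hx', hz⟩ i
    rcases mem_hammingSeg_iff.1 hz i with h | h
    · obtain ⟨t, ht, hti⟩ := (mem_hammingHull_iff hT).1 hx i
      exact ⟨t, Or.inl ht, hti.trans h.symm⟩
    · obtain ⟨t, ht, hti⟩ := (mem_hammingHull_iff hT').1 hx' i
      exact ⟨t, Or.inr ht, hti.trans h.symm⟩
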